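/- (C^r continuity across a common edge, Farin.) Let A, B, C, Ĉ ∈ ℝ² be such that K = ⟨A,B,C⟩ and K̂ = ⟨Ĉ,B,A⟩ are nondegenerate triangles, and let α = (α₁,α₂,α₃) be the barycentric coordinates of Ĉ with respect to (A,B,C). Let P, P̂ : ℝ² → ℝ be polynomial functions of degree ≤ d given in Bernstein–Bézier form P(V) = Σ_{|μ|=d} b_μ B_μ^d(λ(V)) and P̂(V) = Σ_{|μ|=d} b̂_μ B_μ^d(λ̂(V)), where λ(V), λ̂(V) are the barycentric coordinates of V with respect to (A,B,C) and (Ĉ,B,A) respectively. Let 0 ≤ r ≤ d. Then all partial derivatives of P and P̂ of order ≤ r agree at every point of the line through A and B if and only if for all 0 ≤ k ≤ r and 0 ≤ ρ ≤ d−k one has b̂_{(k, ρ, d−k−ρ)} = b^k_{(d−k−ρ, ρ, 0)}(α), where b^0_μ(α) = b_μ and, for k ≥ 1 and |μ| = d−k, b^k_μ(α) = Σ_{i=1}^{3} α_i b^{k−1}_{μ+ε_i}(α). -/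

import Mathlib

open Finset

/-- The trivariate Bernstein polynomial `B_a^d(l) = (d!/(a₁!a₂!a₃!)) l₁^{a₁} l₂^{a₂} l₃^{a₃}`. -/
noncomputable def Bern (d : ℕ) (a : Fin 3 → ℕ) (l : Fin 3 → ℝ) : ℝ :=
  ((Nat.factorial d : ℝ) /
      ((Nat.factorial (a 0) : ℝ) * (Nat.factorial (a 1) : ℝ) * (Nat.factorial (a 2) : ℝ))) *
    (l 0 ^ a 0 * l 1 ^ a 1 * l 2 ^ a 2)

/-- The `k`-th standard basis multi-index `ε_k` of `ℕ³`. -/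
def eps (k : Fin 3) : Fin 3 → ℕ := fun j => if j = k then 1 else 0

/-- The univariate Bernstein polynomial `B_k^n(t) = (n choose k) t^k (1-t)^{n-k}`
(automatically `0` when `k > n`). -/
noncomputable def bern1 (n k : ℕ) (t : ℝ) : ℝ :=
  (Nat.choose n k : ℝ) * t ^ k * (1 - t) ^ (n - k)

/-- The recursively defined coefficients `b^k_μ(α)`:
`b^0_μ(α) = b_μ` and `b^k_μ(α) = Σ_{i=1}^{3} α_i b^{k-1}_{μ+ε_i}(α)`. -/
noncomputable def bIter (b : (Fin 3 → ℕ) → ℝ) (al : Fin 3 → ℝ) : ℕ → (Fin 3 → ℕ) → ℝ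
  | 0 => b
  | k + 1 => fun μ => ∑ i : Fin 3, al i * bIter b al k (μ + eps i)

/-- one de Casteljau step -/
noncomputable def castel (l : Fin 3 → ℝ) (f : (Fin 3 → ℕ) → ℝ) : (Fin 3 → ℕ) → ℝ :=
  fun μ => ∑ i : Fin 3, l i * f (μ + eps i)

lemma bIter_succ (b : (Fin 3 → ℕ) → ℝ) (l : Fin 3 → ℝ) (k : ℕ) :
    bIter b l (k + 1) = castel l (bIter b l k) := rfl

lemma castel_comm (l m : Fin 3 → ℝ) (f : (Fin 3 → ℕ) → ℝ) :
    castel l (castel m f) = castel m (castel l f) := by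
  funext μ
  simp only [castel, Finset.mul_sum]
  rw [Finset.sum_comm]
  refine Finset.sum_congr rfl fun i _ => Finset.sum_congr rfl fun j _ => ?_
  rw [add_right_comm]
  ring

lemma bIter_castel (b : (Fin 3 → ℕ) → ℝ) (l m : Fin 3 → ℝ) (k : ℕ) :
    bIter (castel m b) l k = castel m (bIter b l k) := by
  induction k with
  | zero => rfl
  | succ k ih => rw [bIter_succ, ih, bIter_succ, castel_comm]

lemma bern_sub (d : ℕ) (ν : Fin 3 → ℕ) (l : Fin 3 → ℝ) (i : Fin 3) :
    l i * Bern d ν l = (((ν + eps i) i : ℕ) : ℝ) / (d + 1) * Bern (d + 1) (ν + eps i) l := by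
  have hd : (d : ℝ) + 1 ≠ 0 := by positivity
  have h0 : ((ν 0).factorial : ℝ) ≠ 0 := by positivity
  have h1 : ((ν 1).factorial : ℝ) ≠ 0 := by positivity
  have h2 : ((ν 2).factorial : ℝ) ≠ 0 := by positivity
  have g0 : (ν 0 : ℝ) + 1 ≠ 0 := by positivity
  have g1 : (ν 1 : ℝ) + 1 ≠ 0 := by positivity
  have g2 : (ν 2 : ℝ) + 1 ≠ 0 := by positivity
  fin_cases i <;> simp [Bern, eps, Nat.factorial_succ] <;> field_simp <;> ring

lemma bern_sum_succ (d : ℕ) (b : (Fin 3 → ℕ) → ℝ) (l : Fin 3 → ℝ) :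
    ∑ μ ∈ Finset.Nat.antidiagonalTuple 3 (d + 1), b μ * Bern (d + 1) μ l
      = ∑ μ ∈ Finset.Nat.antidiagonalTuple 3 d, castel l b μ * Bern d μ l := by
  have hd : (d : ℝ) + 1 ≠ 0 := by positivity
  have key : ∀ i : Fin 3,
      ∑ ν ∈ Finset.Nat.antidiagonalTuple 3 d, b (ν + eps i) * (l i * Bern d ν l)
      = ∑ μ ∈ Finset.Nat.antidiagonalTuple 3 (d + 1),
          b μ * ((μ i : ℝ) / (d + 1) * Bern (d + 1) μ l) := by
    intro i
    refine Finset.sum_of_injOn (fun ν => ν + eps i) ?_ ?_ ?_ ?_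
    · intro x _ y _ h
      exact add_right_cancel h
    · intro x hx
      simp only [Finset.mem_coe, Finset.Nat.mem_antidiagonalTuple, Fin.sum_univ_three] at hx ⊢
      fin_cases i <;> simp [eps] <;> omega
    · intro μ hμ hn
      have : μ i = 0 := by
        by_contra hne
        apply hn
        refine ⟨fun j => μ j - eps i j, ?_, ?_⟩
        · simp only [Finset.mem_coe, Finset.Nat.mem_antidiagonalTuple, Fin.sum_univ_three] at hμ ⊢
          fin_cases i <;> simp [eps] at hne ⊢ <;> omega
        · funext j
          simp only [Pi.add_apply, eps]
          split_ifs with h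
          · subst h; omega
          · omega
      simp [this]
    · intro ν _
      rw [bern_sub]
  calc ∑ μ ∈ Finset.Nat.antidiagonalTuple 3 (d + 1), b μ * Bern (d + 1) μ l
      = ∑ μ ∈ Finset.Nat.antidiagonalTuple 3 (d + 1), ∑ i : Fin 3,
          b μ * ((μ i : ℝ) / (d + 1) * Bern (d + 1) μ l) := by
        refine Finset.sum_congr rfl fun μ hμ => ?_
        simp only [Finset.Nat.mem_antidiagonalTuple, Fin.sum_univ_three] at hμ
        have hμ' : (μ 0 : ℝ) + μ 1 + μ 2 = d + 1 := by exact_mod_cast hμ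
        rw [Fin.sum_univ_three]
        have : (μ 0 : ℝ) / (d + 1) + μ 1 / (d + 1) + μ 2 / (d + 1) = 1 := by
          rw [← add_div, ← add_div, hμ', div_self hd]
        linear_combination (-(b μ * Bern (d + 1) μ l)) * this
    _ = ∑ i : Fin 3, ∑ ν ∈ Finset.Nat.antidiagonalTuple 3 d,
          b (ν + eps i) * (l i * Bern d ν l) := by
        rw [Finset.sum_comm]
        exact Finset.sum_congr rfl fun i _ => (key i).symm
    _ = _ := by
        rw [Finset.sum_comm]
        refine Finset.sum_congr rfl fun ν _ => ?_
        rw [castel, Finset.sum_mul]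
        exact Finset.sum_congr rfl fun i _ => by ring

lemma bern_sum_eq (d : ℕ) (b : (Fin 3 → ℕ) → ℝ) (l : Fin 3 → ℝ) :
    ∑ μ ∈ Finset.Nat.antidiagonalTuple 3 d, b μ * Bern d μ l = bIter b l d 0 := by
  induction d generalizing b with
  | zero =>
    rw [Finset.sum_eq_single (0 : Fin 3 → ℕ)]
    · simp [bIter, Bern]
    · intro μ hμ hne
      exfalso
      apply hne
      simp only [Finset.Nat.mem_antidiagonalTuple, Fin.sum_univ_three] at hμ
      funext j
      fin_cases j <;> simp <;> omega
    · intro hn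
      exact absurd (by simp [Finset.Nat.mem_antidiagonalTuple]) hn
  | succ d ih => rw [bern_sum_succ, ih, bIter_castel, bIter_succ]

/-- change of triangle on the level of coefficients -/
lemma bIter_change (b : (Fin 3 → ℕ) → ℝ) (al l m : Fin 3 → ℝ)
    (h0 : l 0 = m 0 * al 0 + m 2) (h1 : l 1 = m 0 * al 1 + m 1) (h2 : l 2 = m 0 * al 2)
    (n : ℕ) (μ : Fin 3 → ℕ) :
    bIter (fun ν => bIter b al (ν 0) ![ν 2, ν 1, 0]) m n μ
      = bIter (bIter b l n) al (μ 0) ![μ 2, μ 1, 0] := by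
  induction n generalizing μ with
  | zero => rfl
  | succ n ih =>
    rw [bIter_succ, castel, Fin.sum_univ_three, ih, ih, ih, bIter_succ, bIter_castel]
    have e0 : (![μ 2, μ 1, 0] : Fin 3 → ℕ) + eps 0 = ![μ 2 + 1, μ 1, 0] := by
      funext j; fin_cases j <;> simp [eps]
    have e1 : (![μ 2, μ 1, 0] : Fin 3 → ℕ) + eps 1 = ![μ 2, μ 1 + 1, 0] := by
      funext j; fin_cases j <;> simp [eps]
    have f0 : bIter (bIter b l n) al ((μ + eps 0) 0) ![(μ + eps 0) 2, (μ + eps 0) 1, 0]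
        = castel al (bIter (bIter b l n) al (μ 0)) ![μ 2, μ 1, 0] := by
      rw [← bIter_succ]; simp [eps]
    have f1 : bIter (bIter b l n) al ((μ + eps 1) 0) ![(μ + eps 1) 2, (μ + eps 1) 1, 0]
        = bIter (bIter b l n) al (μ 0) (![μ 2, μ 1, 0] + eps 1) := by
      rw [e1]; simp [eps]
    have f2 : bIter (bIter b l n) al ((μ + eps 2) 0) ![(μ + eps 2) 2, (μ + eps 2) 1, 0]
        = bIter (bIter b l n) al (μ 0) (![μ 2, μ 1, 0] + eps 0) := by
      rw [e0]; simp [eps]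
    rw [f0, f1, f2]
    simp only [castel, Fin.sum_univ_three, h0, h1, h2]
    ring

lemma bary_unique (X Y Z : Fin 2 → ℝ) (lam : (Fin 2 → ℝ) → (Fin 3 → ℝ))
    (h : ∀ V : Fin 2 → ℝ, lam V 0 + lam V 1 + lam V 2 = 1 ∧
      ∀ j, V j = lam V 0 * X j + lam V 1 * Y j + lam V 2 * Z j) :
    ∃ D : ℝ, ∀ (V : Fin 2 → ℝ) (a b c : ℝ), a + b + c = 1 →
      (∀ j, V j = a * X j + b * Y j + c * Z j) →
      a = D * ((V 0 - Z 0) * (Y 1 - Z 1) - (V 1 - Z 1) * (Y 0 - Z 0)) ∧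
      b = D * ((V 1 - Z 1) * (X 0 - Z 0) - (V 0 - Z 0) * (X 1 - Z 1)) := by
  obtain ⟨s1, p1⟩ := h (fun j => Z j + if j = 0 then 1 else 0)
  obtain ⟨s2, p2⟩ := h (fun j => Z j + if j = 1 then 1 else 0)
  have p10 := p1 0
  have p11 := p1 1
  have p20 := p2 0
  have p21 := p2 1
  simp at p10 p11 p20 p21
  generalize lam (fun j => Z j + if j = 0 then 1 else 0) = u at *
  generalize lam (fun j => Z j + if j = 1 then 1 else 0) = v at *
  have k1 : u 2 = 1 - u 0 - u 1 := by linarith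
  have k2 : v 2 = 1 - v 0 - v 1 := by linarith
  rw [k1] at p10 p11
  rw [k2] at p20 p21
  have q10 : u 0 * (X 0 - Z 0) + u 1 * (Y 0 - Z 0) = 1 := by linarith
  have q11 : u 0 * (X 1 - Z 1) + u 1 * (Y 1 - Z 1) = 0 := by linarith
  have q20 : v 0 * (X 0 - Z 0) + v 1 * (Y 0 - Z 0) = 0 := by linarith
  have q21 : v 0 * (X 1 - Z 1) + v 1 * (Y 1 - Z 1) = 1 := by linarith
  have hD : ((X 0 - Z 0) * (Y 1 - Z 1) - (X 1 - Z 1) * (Y 0 - Z 0)) * (u 0 * v 1 - u 1 * v 0)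
      = 1 := by
    have : ((X 0 - Z 0) * (Y 1 - Z 1) - (X 1 - Z 1) * (Y 0 - Z 0)) * (u 0 * v 1 - u 1 * v 0)
      = (u 0 * (X 0 - Z 0) + u 1 * (Y 0 - Z 0)) * (v 0 * (X 1 - Z 1) + v 1 * (Y 1 - Z 1))
       - (u 0 * (X 1 - Z 1) + u 1 * (Y 1 - Z 1)) * (v 0 * (X 0 - Z 0) + v 1 * (Y 0 - Z 0)) := by
      ring
    rw [this, q10, q11, q20, q21]; ring
  refine ⟨u 0 * v 1 - u 1 * v 0, fun V a b c hs hV => ?_⟩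
  have hc : c = 1 - a - b := by linarith
  rw [hV 0, hV 1, hc]
  constructor
  · linear_combination (-a) * hD
  · linear_combination (-b) * hD

lemma flat_mul {E : Type*} [NormedAddCommGroup E] [NormedSpace ℝ E] {f g : E → ℝ}
    (hf : ContDiff ℝ (⊤ : ℕ∞) f) (hg : ContDiff ℝ (⊤ : ℕ∞) g) (p : E) (k : ℕ)
    (h : ∀ i ≤ k, iteratedFDeriv ℝ i f p = 0 ∨ iteratedFDeriv ℝ (k - i) g p = 0) :
    iteratedFDeriv ℝ k (fun y => f y * g y) p = 0 := by
  have := norm_iteratedFDeriv_mul_le hf hg p (n := k) (by exact_mod_cast le_top)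
  rw [← norm_le_zero_iff]
  refine this.trans (le_of_eq (Finset.sum_eq_zero fun i hi => ?_))
  rcases h i (by simpa [Nat.lt_succ_iff] using hi) with h | h <;> simp [h]

lemma flat_pow {E : Type*} [NormedAddCommGroup E] [NormedSpace ℝ E] {f : E → ℝ}
    (hf : ContDiff ℝ (⊤ : ℕ∞) f) (p : E) (hp : f p = 0) (m : ℕ) :
    ∀ k < m, iteratedFDeriv ℝ k (fun y => f y ^ m) p = 0 := by
  induction m with
  | zero => intro k hk; omega
  | succ m ih =>
    intro k hk
    simp only [pow_succ']
    refine flat_mul hf (hf.pow m) p k fun i hi => ?_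
    rcases Nat.eq_zero_or_pos i with rfl | hpos
    · left
      ext v
      simp [hp]
    · right
      exact ih _ (by omega)

lemma poly_deriv (G : Polynomial ℝ) (k : ℕ) :
    iteratedDeriv k (fun s => G.eval s) 0 = (k.factorial : ℝ) * G.coeff k := by
  have : ∀ k, iteratedDeriv k (fun s => G.eval s)
      = fun s => (Polynomial.derivative^[k] G).eval s := by
    intro k
    induction k with
    | zero => simp
    | succ k ih =>
      rw [iteratedDeriv_succ, ih, Function.iterate_succ_apply']
      funext s
      exact Polynomial.deriv _
  rw [this]
  simp only
  rw [← Polynomial.coeff_zero_eq_eval_zero, Polynomial.coeff_iterate_derivative]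
  simp [Nat.descFactorial_self]

lemma dir_deriv {E : Type*} [NormedAddCommGroup E] [NormedSpace ℝ E] {f : E → ℝ}
    (hf : ContDiff ℝ (⊤ : ℕ∞) f) (p v : E) (k : ℕ) (h : iteratedFDeriv ℝ k f p = 0) :
    iteratedDeriv k (fun s : ℝ => f (p + s • v)) 0 = 0 := by
  have hc : ContDiff ℝ (⊤ : ℕ∞) (fun z => f (p + z)) := by fun_prop
  have := ContinuousLinearMap.iteratedFDeriv_comp_right
    (ContinuousLinearMap.toSpanSingleton ℝ v) hc 0 (i := k) (by exact_mod_cast le_top)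
  rw [iteratedDeriv_eq_iteratedFDeriv]
  have e : (fun s : ℝ => f (p + s • v))
    = (fun z => f (p + z)) ∘ (ContinuousLinearMap.toSpanSingleton ℝ v) := by
    funext s; simp
  rw [e, this, iteratedFDeriv_comp_add_left]
  simp [h]

/-- coefficient of the Bernstein polynomial -/
noncomputable def mcoef (d : ℕ) (a : Fin 3 → ℕ) : ℝ := (Nat.factorial d : ℝ) /
      ((Nat.factorial (a 0) : ℝ) * (Nat.factorial (a 1) : ℝ) * (Nat.factorial (a 2) : ℝ))

lemma mcoef_ne (d : ℕ) (a : Fin 3 → ℕ) : mcoef d a ≠ 0 := by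
  unfold mcoef; positivity

lemma indep (d k : ℕ) (hk : k ≤ d) (e : (Fin 3 → ℕ) → ℝ)
    (h : ∀ t : ℝ, ∑ μ ∈ (Finset.Nat.antidiagonalTuple 3 d).filter (fun μ => μ 0 = k),
      e μ * mcoef d μ * (t ^ μ 1 * (1 - t) ^ μ 2) = 0) :
    ∀ ρ ≤ d - k, e ![k, ρ, d - k - ρ] = 0 := by
  set S := (Finset.Nat.antidiagonalTuple 3 d).filter (fun μ => μ 0 = k) with hS
  let G : Polynomial ℝ := ∑ μ ∈ S, Polynomial.C (e μ * mcoef d μ) * Polynomial.X ^ μ 1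
  have hmem : ∀ μ, μ ∈ S ↔ μ 0 + μ 1 + μ 2 = d ∧ μ 0 = k := by
    intro μ
    simp [hS, Finset.Nat.mem_antidiagonalTuple, Fin.sum_univ_three]
  have hG : G = 0 := by
    apply Polynomial.eq_zero_of_infinite_isRoot
    refine Set.Infinite.mono ?_ (Set.Ioi_infinite (0 : ℝ))
    intro u hu
    have hu : 0 < u := hu
    have h1 : (1 + u) ≠ 0 := by positivity
    show G.eval u = 0
    have := h (u / (1 + u))
    have h2 : 1 - u / (1 + u) = 1 / (1 + u) := by field_simp; ring
    rw [h2] at this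
    have h3 : G.eval u = (1 + u) ^ (d - k) * ∑ μ ∈ S,
        e μ * mcoef d μ * ((u / (1 + u)) ^ μ 1 * (1 / (1 + u)) ^ μ 2) := by
      simp only [G, Polynomial.eval_finsetSum, Finset.mul_sum]
      refine Finset.sum_congr rfl fun μ hμ => ?_
      obtain ⟨a, b⟩ := (hmem μ).1 hμ
      have : d - k = μ 1 + μ 2 := by omega
      rw [this, pow_add]
      simp only [Polynomial.eval_mul, Polynomial.eval_C, Polynomial.eval_pow, Polynomial.eval_X, div_pow, one_pow]
      field_simp
    rw [h3, this, mul_zero]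
  intro ρ hρ
  have hc : G.coeff ρ = 0 := by rw [hG]; simp
  simp only [G, Polynomial.finsetSum_coeff, Polynomial.coeff_C_mul, Polynomial.coeff_X_pow] at hc
  rw [Finset.sum_eq_single ![k, ρ, d - k - ρ]] at hc
  · have := mcoef_ne d ![k, ρ, d - k - ρ]
    simpa [this] using hc
  · intro μ hμ hne
    obtain ⟨a, b⟩ := (hmem μ).1 hμ
    have : ρ ≠ μ 1 := by
      rintro rfl
      apply hne
      funext j
      fin_cases j
      · simpa using b
      · simp
      · simp; omega
    simp [this]
  · intro hn
    exact absurd ((hmem _).2 ⟨by simp; omega, by simp⟩) hn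

lemma forward (d r : ℕ) (hrd : r ≤ d) (e : (Fin 3 → ℕ) → ℝ)
    (h : ∀ k ≤ r, ∀ t : ℝ, iteratedDeriv k (fun s : ℝ =>
      ∑ μ ∈ Finset.Nat.antidiagonalTuple 3 d, e μ * Bern d μ ![s, t, 1 - t - s]) 0 = 0) :
    ∀ k ≤ r, ∀ ρ ≤ d - k, e ![k, ρ, d - k - ρ] = 0 := by
  intro k
  induction k using Nat.strong_induction_on with
  | _ k ih =>
  intro hk
  refine indep d k (hk.trans hrd) e fun t => ?_
  let G : Polynomial ℝ := ∑ μ ∈ Finset.Nat.antidiagonalTuple 3 d,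
    Polynomial.X ^ μ 0 * (Polynomial.C (e μ * mcoef d μ * t ^ μ 1) *
      (Polynomial.C (1 - t) - Polynomial.X) ^ μ 2)
  have hG : (fun s : ℝ =>
      ∑ μ ∈ Finset.Nat.antidiagonalTuple 3 d, e μ * Bern d μ ![s, t, 1 - t - s])
      = fun s => G.eval s := by
    funext s
    simp only [G, Polynomial.eval_finsetSum]
    refine Finset.sum_congr rfl fun μ _ => ?_
    simp [Bern, mcoef]
    ring
  have h1 := h k hk t
  rw [hG, poly_deriv] at h1
  have h2 : G.coeff k = 0 := by
    have : (k.factorial : ℝ) ≠ 0 := by positivity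
    simpa [this] using h1
  rw [← h2]
  simp only [G, Polynomial.finsetSum_coeff]
  rw [Finset.sum_filter]
  refine Finset.sum_congr rfl fun μ hμ => ?_
  rw [Polynomial.coeff_X_pow_mul']
  simp only [Finset.Nat.mem_antidiagonalTuple, Fin.sum_univ_three] at hμ
  rcases lt_trichotomy (μ 0) k with hlt | heq | hgt
  · have := ih (μ 0) hlt (by omega) (μ 1) (by omega)
    have e1 : (![μ 0, μ 1, d - μ 0 - μ 1] : Fin 3 → ℕ) = μ := by
      funext j
      fin_cases j
      · simp
      · simp
      · simp; omega
    rw [e1] at this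
    simp [this]
  · simp [heq, Polynomial.coeff_zero_eq_eval_zero]
    ring
  · rw [if_neg (by omega), if_neg (by omega)]

lemma backward (d r : ℕ) (e : (Fin 3 → ℕ) → ℝ) (l : (Fin 2 → ℝ) → (Fin 3 → ℝ))
    (hl : ∀ i, ContDiff ℝ (⊤ : ℕ∞) (fun V => l V i)) (p : Fin 2 → ℝ) (hp : l p 0 = 0)
    (h : ∀ k ≤ r, ∀ ρ ≤ d - k, e ![k, ρ, d - k - ρ] = 0) (k : ℕ) (hk : k ≤ r) :
    iteratedFDeriv ℝ k (fun V =>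
      ∑ μ ∈ Finset.Nat.antidiagonalTuple 3 d, e μ * Bern d μ (l V)) p = 0 := by
  have hl0 := hl 0
  have hl1 := hl 1
  have hl2 := hl 2
  rw [iteratedFDeriv_fun_sum_apply]
  · refine Finset.sum_eq_zero fun μ hμ => ?_
    simp only [Finset.Nat.mem_antidiagonalTuple, Fin.sum_univ_three] at hμ
    by_cases hr : μ 0 ≤ r
    · have := h (μ 0) hr (μ 1) (by omega)
      have e1 : (![μ 0, μ 1, d - μ 0 - μ 1] : Fin 3 → ℕ) = μ := by
        funext j
        fin_cases j
        · simp
        · simp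
        · simp; omega
      rw [e1] at this
      simp only [this, zero_mul]
      simp
    · have : (fun V => e μ * Bern d μ (l V)) = fun V => (l V 0) ^ μ 0 *
          (e μ * mcoef d μ * ((l V 1) ^ μ 1 * (l V 2) ^ μ 2)) := by
        funext V
        simp only [Bern, mcoef]
        ring
      rw [this]
      refine flat_mul (hl0.pow _) (by fun_prop) p k fun i hi => Or.inl ?_
      exact flat_pow hl0 p hp _ i (by omega)
  · intro μ _
    have : ContDiff ℝ (⊤ : ℕ∞) (fun V => e μ * Bern d μ (l V)) := by
      unfold Bern; fun_prop
    exact (this.of_le (by exact_mod_cast le_top)).contDiffAt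

theorem stmt11 (d r : ℕ) (hrd : r ≤ d)
    (A B C Chat : Fin 2 → ℝ)
    (hK : AffineIndependent ℝ ![A, B, C])
    (hKhat : AffineIndependent ℝ ![Chat, B, A])
    (al : Fin 3 → ℝ) (hal1 : al 0 + al 1 + al 2 = 1)
    (halC : ∀ j, Chat j = al 0 * A j + al 1 * B j + al 2 * C j)
    (lam lamhat : (Fin 2 → ℝ) → (Fin 3 → ℝ))
    (hlam : ∀ V : Fin 2 → ℝ, lam V 0 + lam V 1 + lam V 2 = 1 ∧
      ∀ j, V j = lam V 0 * A j + lam V 1 * B j + lam V 2 * C j)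
    (hlamhat : ∀ V : Fin 2 → ℝ, lamhat V 0 + lamhat V 1 + lamhat V 2 = 1 ∧
      ∀ j, V j = lamhat V 0 * Chat j + lamhat V 1 * B j + lamhat V 2 * A j)
    (b bhat : (Fin 3 → ℕ) → ℝ) (P Phat : (Fin 2 → ℝ) → ℝ)
    (hP : ∀ V, P V = ∑ μ ∈ Finset.Nat.antidiagonalTuple 3 d, b μ * Bern d μ (lam V))
    (hPhat : ∀ V, Phat V = ∑ μ ∈ Finset.Nat.antidiagonalTuple 3 d, bhat μ * Bern d μ (lamhat V)) :
    (∀ k ≤ r, ∀ t : ℝ,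
        iteratedFDeriv ℝ k P (fun j => A j + t * (B j - A j)) =
          iteratedFDeriv ℝ k Phat (fun j => A j + t * (B j - A j))) ↔
      (∀ k ≤ r, ∀ ρ ≤ d - k,
        bhat ![k, ρ, d - k - ρ] = bIter b al k ![d - k - ρ, ρ, 0]) := by
  obtain ⟨D, hD⟩ := bary_unique A B C lam hlam
  obtain ⟨E, hE⟩ := bary_unique Chat B A lamhat hlamhat
  have u0 : ∀ V, lamhat V 0 = _ := fun V => (hE V _ _ _ (hlamhat V).1 (hlamhat V).2).1
  have u1 : ∀ V, lamhat V 1 = _ := fun V => (hE V _ _ _ (hlamhat V).1 (hlamhat V).2).2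
  have u2 : ∀ V, lamhat V 2 = 1 - lamhat V 0 - lamhat V 1 := fun V => by
    linarith [(hlamhat V).1]
  have c0 : ContDiff ℝ (⊤ : ℕ∞) (fun V => lamhat V 0) := by
    simp only [u0]; fun_prop
  have c1 : ContDiff ℝ (⊤ : ℕ∞) (fun V => lamhat V 1) := by
    simp only [u1]; fun_prop
  have c2 : ContDiff ℝ (⊤ : ℕ∞) (fun V => lamhat V 2) := by
    simp only [u2]; fun_prop
  have hc : ∀ i, ContDiff ℝ (⊤ : ℕ∞) (fun V => lamhat V i) := by
    intro i; fin_cases i <;> assumption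
  -- relation between the barycentric coordinates
  have hrel : ∀ V, lam V 0 = lamhat V 0 * al 0 + lamhat V 2 ∧
      lam V 1 = lamhat V 0 * al 1 + lamhat V 1 ∧ lam V 2 = lamhat V 0 * al 2 := by
    intro V
    obtain ⟨s, hs⟩ := hlam V
    obtain ⟨s', hs'⟩ := hlamhat V
    have a1 := hD V _ _ _ s hs
    have a2 := hD V (lamhat V 0 * al 0 + lamhat V 2) (lamhat V 0 * al 1 + lamhat V 1)
      (lamhat V 0 * al 2) (by linear_combination s' + lamhat V 0 * hal1) (by
        intro j
        rw [hs' j, halC j]; ring)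
    have e0 := a1.1.trans a2.1.symm
    have e1 := a1.2.trans a2.2.symm
    refine ⟨e0, e1, ?_⟩
    linear_combination s - e0 - e1 - s' - lamhat V 0 * hal1
  set c : (Fin 3 → ℕ) → ℝ := fun ν => bIter b al (ν 0) ![ν 2, ν 1, 0] with hcdef
  have hP' : P = fun V => ∑ μ ∈ Finset.Nat.antidiagonalTuple 3 d, c μ * Bern d μ (lamhat V) := by
    funext V
    obtain ⟨r0, r1, r2⟩ := hrel V
    rw [hP, bern_sum_eq, bern_sum_eq, bIter_change b al (lam V) (lamhat V) r0 r1 r2]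
    simp only [Pi.zero_apply, bIter]
    congr 1
    funext j; fin_cases j <;> rfl
  have hQ' : Phat = fun V =>
      ∑ μ ∈ Finset.Nat.antidiagonalTuple 3 d, bhat μ * Bern d μ (lamhat V) := funext hPhat
  have smooth : ∀ f : (Fin 3 → ℕ) → ℝ, ContDiff ℝ (⊤ : ℕ∞) (fun V =>
      ∑ μ ∈ Finset.Nat.antidiagonalTuple 3 d, f μ * Bern d μ (lamhat V)) := by
    intro f
    unfold Bern
    fun_prop
  have sP : ContDiff ℝ (⊤ : ℕ∞) P := hP' ▸ smooth c
  have sQ : ContDiff ℝ (⊤ : ℕ∞) Phat := hQ' ▸ smooth bhat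
  have hdiff : Phat - P = fun V =>
      ∑ μ ∈ Finset.Nat.antidiagonalTuple 3 d, (bhat - c) μ * Bern d μ (lamhat V) := by
    rw [hP', hQ']
    funext V
    simp only [Pi.sub_apply, sub_mul, Finset.sum_sub_distrib]
  have hiff : ∀ k p, iteratedFDeriv ℝ k P p = iteratedFDeriv ℝ k Phat p ↔
      iteratedFDeriv ℝ k (Phat - P) p = 0 := by
    intro k p
    rw [iteratedFDeriv_sub_apply (sQ.of_le (by exact_mod_cast le_top)).contDiffAt
      (sP.of_le (by exact_mod_cast le_top)).contDiffAt, sub_eq_zero, eq_comm]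
  have hiff2 : (∀ k ≤ r, ∀ ρ ≤ d - k,
        bhat ![k, ρ, d - k - ρ] = bIter b al k ![d - k - ρ, ρ, 0]) ↔
      (∀ k ≤ r, ∀ ρ ≤ d - k, (bhat - c) ![k, ρ, d - k - ρ] = 0) := by
    simp [hcdef, sub_eq_zero]
  have hcoord : ∀ t s : ℝ, lamhat ((fun j => A j + t * (B j - A j)) + s • (Chat - A))
      = ![s, t, 1 - t - s] := by
    intro t s
    set V := (fun j => A j + t * (B j - A j)) + s • (Chat - A) with hV
    obtain ⟨q0, q1⟩ := hE V s t (1 - t - s) (by ring) (by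
      intro j; simp [hV]; ring)
    have e0 := (u0 V).trans q0.symm
    have e1 := (u1 V).trans q1.symm
    funext j
    fin_cases j
    · simpa using e0
    · simpa using e1
    · simp [u2, e0, e1]; ring
  simp only [hiff]
  rw [hiff2]
  constructor
  · intro h
    refine forward d r hrd _ fun k hk t => ?_
    have hs : ContDiff ℝ (⊤ : ℕ∞) (Phat - P) := sQ.sub sP
    have := dir_deriv hs _ (Chat - A) k (h k hk t)
    simpa only [hdiff, hcoord] using this
  · intro h k hk t
    rw [hdiff]
    refine backward d r _ lamhat hc _ ?_ h k hk
    have := hcoord t 0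
    rw [zero_smul, add_zero] at this
    rw [this]; rfl
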